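/- arXiv:1103.6213 — 2 statements merged into one kernel-verified Lean document; each statement's English description precedes it below -/
import Mathlib

section
/- Let V be a Hermitian space of dimension d and let f : D'(d) → D'(d) be a continuous facial map. Then there exists exactly one map A_f : s(V) → s(V) satisfying A_f(ν'(α,t)) = ν'(α, f(t)) for all α ∈ 𝓛(ℂ^d, V) and t ∈ D'(d), where ν'(α,t) := α ∘ Δ(t) ∘ α† (Δ(t) the diagonal matrix with entries t); moreover this A_f is continuous and satisfies η' ∘ A_f = f ∘ η', where η'(β) := (e_0(β),…,e_{d−1}(β)). Explicitly, if (v_0,…,v_{d−1}) is an orthonormal basis of eigenvectors of β ∈ s(V) with eigenvalues e_0(β) ≤ … ≤ e_{d−1}(β) and f(e_0(β),…,e_{d−1}(β)) = (s_0,…,s_{d−1}), then A_f(β) is the self-adjoint endomorphism with A_f(β)v_i = s_i v_i. -/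
open ContinuousLinearMap

/-- The self-adjoint endomorphism of `ℂ^d` given by the diagonal matrix with entries `t`. -/
noncomputable def diagCLM {d : ℕ} (t : Fin d → ℝ) :
    EuclideanSpace ℂ (Fin d) →L[ℂ] EuclideanSpace ℂ (Fin d) :=
  Matrix.toEuclideanCLM (𝕜 := ℂ) (Matrix.diagonal fun i => (t i : ℂ))

section

variable {V : Type*} [NormedAddCommGroup V] [InnerProductSpace ℂ V] {d : ℕ}

theorem diagCLM_single (t : Fin d → ℝ) (i : Fin d) :
    diagCLM t (EuclideanSpace.single i (1 : ℂ)) =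
      (t i : ℂ) • EuclideanSpace.single i (1 : ℂ) := by
  ext j
  simp [diagCLM, Matrix.ofLp_toEuclideanCLM, Matrix.mulVec_diagonal, Pi.single_apply]
  grind

theorem isSelfAdjoint_diagCLM (t : Fin d → ℝ) : IsSelfAdjoint (diagCLM t) := by
  refine IsSelfAdjoint.map ?_ (Matrix.toEuclideanCLM (n := Fin d) (𝕜 := ℂ))
  rw [IsSelfAdjoint, Matrix.star_eq_conjTranspose, Matrix.diagonal_conjTranspose]
  congr 1
  ext i
  simp

theorem continuous_diagCLM : Continuous (diagCLM (d := d)) := by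
  have h : Continuous (Matrix.toEuclideanCLM (n := Fin d) (𝕜 := ℂ)) :=
    LinearMap.continuous_of_finiteDimensional
      (Matrix.toEuclideanCLM (n := Fin d) (𝕜 := ℂ)).toAlgEquiv.toLinearMap
  refine h.comp (Continuous.matrix_diagonal ?_)
  fun_prop

theorem norm_le_of_eigenbasis {β : V →L[ℂ] V} {t : Fin d → ℝ}
    {v : OrthonormalBasis (Fin d) ℂ V} (h : ∀ i, β (v i) = (t i : ℂ) • v i) : ‖t‖ ≤ ‖β‖ := by
  refine (pi_norm_le_iff_of_nonneg (norm_nonneg _)).mpr fun i => ?_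
  simpa [h, norm_smul] using β.le_opNorm (v i)

variable [FiniteDimensional ℂ V]

/-- An isometry `θ : ℂ^d → V` onto a `d`-dimensional space carries the standard basis to an
orthonormal basis; `θ ∘ Δ(t) ∘ θ†` is the endomorphism that is diagonal in it with entries `t`. -/
theorem exists_orthonormalBasis_eq_conj_diagCLM_iff (hd : Module.finrank ℂ V = d)
    (θ : EuclideanSpace ℂ (Fin d) →L[ℂ] V) (hθ : ∀ x, ‖θ x‖ = ‖x‖) :
    ∃ v : OrthonormalBasis (Fin d) ℂ V, (∀ i, v i = θ (EuclideanSpace.single i 1)) ∧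
      ∀ (β : V →L[ℂ] V) (t : Fin d → ℝ), β = θ ∘L diagCLM t ∘L adjoint θ ↔ ∀ i, β (v i) = (t i : ℂ) • v i := by
  let e : EuclideanSpace ℂ (Fin d) ≃ₗᵢ[ℂ] V :=
    LinearIsometry.toLinearIsometryEquiv ⟨θ.toLinearMap, hθ⟩ (by simp [hd])
  let v := (EuclideanSpace.basisFun (Fin d) ℂ).map e
  have hv : ∀ i, v i = θ (EuclideanSpace.single i 1) := fun i => by simp [v, e]
  have hadj : ∀ i, adjoint θ (v i) = EuclideanSpace.single i 1 := fun i => by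
    have h : adjoint θ ∘L θ = ContinuousLinearMap.id ℂ _ :=
      (norm_map_iff_adjoint_comp_self θ).mp hθ
    rw [hv]
    exact DFunLike.congr_fun h _
  have happ : ∀ (t : Fin d → ℝ) i, (θ ∘L diagCLM t ∘L adjoint θ) (v i) = (t i : ℂ) • v i := by
    intro t i
    simp only [ContinuousLinearMap.comp_apply, hadj, diagCLM_single, map_smul, ← hv]
  refine ⟨v, hv, fun β t => ⟨?_, fun h => ?_⟩⟩
  · rintro rfl
    exact happ t
  · refine ContinuousLinearMap.coe_injective (v.toBasis.ext fun i => ?_)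
    simpa using (h i).trans (happ t i).symm

/-- Every orthonormal basis arises from an isometry `ℂ^d → V`. -/
theorem exists_isometry_eq_conj_diagCLM (v : OrthonormalBasis (Fin d) ℂ V) :
    ∃ θ : EuclideanSpace ℂ (Fin d) →L[ℂ] V, (∀ x, ‖θ x‖ = ‖x‖) ∧
      ∀ (β : V →L[ℂ] V) (t : Fin d → ℝ), (∀ i, β (v i) = (t i : ℂ) • v i) →
        β = θ ∘L diagCLM t ∘L adjoint θ := by
  let θ : EuclideanSpace ℂ (Fin d) →L[ℂ] V := v.repr.symm.toContinuousLinearEquiv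
  have hθ : ∀ x, ‖θ x‖ = ‖x‖ := v.repr.symm.norm_map
  obtain ⟨w, hw, h⟩ := exists_orthonormalBasis_eq_conj_diagCLM_iff
    (by simpa using Module.finrank_eq_card_basis v.toBasis) θ hθ
  have hwv : ∀ i, w i = v i := fun i => (hw i).trans (v.repr_symm_single i)
  exact ⟨θ, hθ, fun β t hv => (h β t).mpr fun i => by rw [hwv, hv]⟩

theorem exists_monotone_eigenbasis (hd : Module.finrank ℂ V = d) {β : V →L[ℂ] V}
    (hβ : IsSelfAdjoint β) :
    ∃ (t : Fin d → ℝ) (v : OrthonormalBasis (Fin d) ℂ V),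
      Monotone t ∧ ∀ i, β (v i) = (t i : ℂ) • v i := by
  have hs : (β : V →ₗ[ℂ] V).IsSymmetric := hβ.isSymmetric
  refine ⟨hs.eigenvalues hd ∘ Fin.rev, (hs.eigenvectorBasis hd).reindex Fin.revPerm,
    (hs.eigenvalues_antitone hd).comp fun i j h => Fin.rev_le_rev.mpr h, fun i => ?_⟩
  rw [OrthonormalBasis.reindex_apply]
  exact hs.apply_eigenvectorBasis hd i.rev

theorem exists_isometry_conj_diagCLM (hd : Module.finrank ℂ V = d) {β : V →L[ℂ] V}
    (hβ : IsSelfAdjoint β) :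
    ∃ (θ : EuclideanSpace ℂ (Fin d) →L[ℂ] V) (t : Fin d → ℝ), (∀ x, ‖θ x‖ = ‖x‖) ∧
      Monotone t ∧ β = θ ∘L diagCLM t ∘L adjoint θ := by
  obtain ⟨t, v, ht, hv⟩ := exists_monotone_eigenbasis hd hβ
  obtain ⟨θ, hθ, h⟩ := exists_isometry_eq_conj_diagCLM v
  exact ⟨θ, t, hθ, ht, h β t hv⟩

theorem isSelfAdjoint_conj_diagCLM (θ : EuclideanSpace ℂ (Fin d) →L[ℂ] V) (t : Fin d → ℝ) :
    IsSelfAdjoint (θ ∘L diagCLM t ∘L adjoint θ) :=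
  (isSelfAdjoint_diagCLM t).conj_adjoint θ

theorem continuous_conj_diagCLM :
    Continuous fun p : (EuclideanSpace ℂ (Fin d) →L[ℂ] V) × (Fin d → ℝ) =>
      p.1 ∘L diagCLM p.2 ∘L adjoint p.1 := by
  have h : Continuous fun θ : EuclideanSpace ℂ (Fin d) →L[ℂ] V => adjoint θ :=
    (adjoint : (EuclideanSpace ℂ (Fin d) →L[ℂ] V) ≃ₗᵢ⋆[ℂ] _).continuous
  exact continuous_fst.clm_comp
    ((continuous_diagCLM.comp continuous_snd).clm_comp (h.comp continuous_fst))

theorem charpoly_eq_prod_of_eigenbasis {β : V →L[ℂ] V} {t : Fin d → ℝ}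
    {v : OrthonormalBasis (Fin d) ℂ V} (h : ∀ i, β (v i) = (t i : ℂ) • v i) :
    (β : V →ₗ[ℂ] V).charpoly = ∏ i, (Polynomial.X - Polynomial.C (t i : ℂ)) := by
  have hm : LinearMap.toMatrix v.toBasis v.toBasis (β : V →ₗ[ℂ] V) =
      Matrix.diagonal fun i => (t i : ℂ) := by
    ext i j
    simp [LinearMap.toMatrix_apply, h, Matrix.diagonal_apply, -Complex.coe_smul]
    grind
  rw [← LinearMap.charpoly_toMatrix _ v.toBasis, hm, Matrix.charpoly_diagonal]

theorem monotone_eigenvalues_unique {β : V →L[ℂ] V} {t u : Fin d → ℝ}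
    (ht : Monotone t) (hu : Monotone u) {v w : OrthonormalBasis (Fin d) ℂ V}
    (hv : ∀ i, β (v i) = (t i : ℂ) • v i) (hw : ∀ i, β (w i) = (u i : ℂ) • w i) : t = u := by
  have hroots : ∀ s : Fin d → ℝ,
      (∏ i, (Polynomial.X - Polynomial.C (s i : ℂ))).roots.map Complex.re =
        (List.ofFn s : Multiset ℝ) := fun s => by
    rw [Polynomial.roots_prod _ _ (Finset.prod_ne_zero_iff.mpr fun i _ =>
      Polynomial.X_sub_C_ne_zero _)]
    simp [← Fin.univ_val_map, Multiset.map_map]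
  have hp : (List.ofFn t : Multiset ℝ) = List.ofFn u := by
    rw [← hroots t, ← hroots u, ← charpoly_eq_prod_of_eigenbasis hv,
      charpoly_eq_prod_of_eigenbasis hw]
  exact List.ofFn_injective
    ((Multiset.coe_eq_coe.mp hp).eq_of_sortedLE ht.sortedLE_ofFn hu.sortedLE_ofFn)

/-- If `β` is diagonal with entries `t` in two orthonormal bases, then so is every `γ` that is
diagonal in one of them with entries that agree wherever those of `t` do. -/
theorem diagonal_of_diagonal_of_eigenbases {β γ : V →L[ℂ] V} (hβ : IsSelfAdjoint β)
    (hγ : IsSelfAdjoint γ) {t s : Fin d → ℝ} (hts : ∀ i j, t i = t j → s i = s j)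
    {v w : OrthonormalBasis (Fin d) ℂ V}
    (hv : ∀ i, β (v i) = (t i : ℂ) • v i) (hw : ∀ i, β (w i) = (t i : ℂ) • w i)
    (hγw : ∀ i, γ (w i) = (s i : ℂ) • w i) (i : Fin d) : γ (v i) = (s i : ℂ) • v i := by
  refine InnerProductSpace.ext_inner_left_basis w.toBasis fun j => ?_
  have h1 : inner ℂ (β (w j)) (v i) = inner ℂ (w j) (β (v i)) := hβ.isSymmetric _ _
  have h2 : inner ℂ (γ (w j)) (v i) = inner ℂ (w j) (γ (v i)) := hγ.isSymmetric _ _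
  simp only [hv, hw, hγw, inner_smul_left, inner_smul_right, Complex.conj_ofReal] at h1 h2
  rw [OrthonormalBasis.coe_toBasis, ← h2, inner_smul_right]
  rcases mul_eq_mul_right_iff.mp h1 with h | h
  · rw [hts j i (by exact_mod_cast h)]
  · simp [h]

theorem isCompact_isometries :
    IsCompact {θ : EuclideanSpace ℂ (Fin d) →L[ℂ] V | ∀ x, ‖θ x‖ = ‖x‖} := by
  have : ProperSpace (EuclideanSpace ℂ (Fin d) →L[ℂ] V) := FiniteDimensional.proper ℂ _
  refine Metric.isCompact_of_isClosed_isBounded ?_ ?_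
  · simp only [Set.ofPred_forall]
    exact isClosed_iInter fun x => isClosed_eq (by fun_prop) continuous_const
  · refine Metric.isBounded_closedBall (x := 0) (r := 1) |>.subset fun θ hθ => ?_
    rw [mem_closedBall_zero_iff]
    exact θ.opNorm_le_bound zero_le_one fun x => by rw [hθ x, one_mul]

theorem isCompact_monotone_closedBall (r : ℝ) :
    IsCompact {t : {t : Fin d → ℝ // Monotone t} | ‖t.1‖ ≤ r} := by
  have h : Topology.IsClosedEmbedding (Subtype.val : {t : Fin d → ℝ // Monotone t} → _) :=
    isClosed_monotone.isClosedEmbedding_subtypeVal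
  convert h.isCompact_preimage (isCompact_closedBall (0 : Fin d → ℝ) r) using 1
  ext t
  simp

/-- A map on self-adjoint operators that acts on eigenvalue tuples through a continuous `f` is
continuous. -/
theorem continuous_of_conj_diagCLM (hd : Module.finrank ℂ V = d)
    {f : {t : Fin d → ℝ // Monotone t} → {t : Fin d → ℝ // Monotone t}} (hf : Continuous f)
    {A : {α : V →L[ℂ] V // IsSelfAdjoint α} → {α : V →L[ℂ] V // IsSelfAdjoint α}}
    (hA : ∀ (β : {α : V →L[ℂ] V // IsSelfAdjoint α})
      (θ : {θ : EuclideanSpace ℂ (Fin d) →L[ℂ] V // ∀ x, ‖θ x‖ = ‖x‖})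
      (t : {t : Fin d → ℝ // Monotone t}),
      (β : V →L[ℂ] V) = θ.1 ∘L diagCLM t.1 ∘L adjoint θ.1 →
      (A β : V →L[ℂ] V) = θ.1 ∘L diagCLM (f t).1 ∘L adjoint θ.1) : Continuous A := by
  choose θ t hθ ht hβ using fun β : {α : V →L[ℂ] V // IsSelfAdjoint α} =>
    exists_isometry_conj_diagCLM hd β.2
  refine continuous_iff_ultrafilter.mpr fun β g hg => tendsto_subtype_rng.mpr ?_
  have hg' : Filter.Tendsto (Subtype.val : {α : V →L[ℂ] V // IsSelfAdjoint α} → _) g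
      (nhds β.1) := continuous_subtype_val.continuousAt.mono_left hg
  have hbound : ∀ᶠ γ in (g : Filter _), ‖t γ‖ ≤ ‖β.1‖ + 1 := by
    filter_upwards [hg'.norm.eventually_le_const (lt_add_one _)] with γ hγ
    obtain ⟨v, -, hv⟩ := exists_orthonormalBasis_eq_conj_diagCLM_iff hd (θ γ) (hθ γ)
    exact (norm_le_of_eigenbasis ((hv _ _).mp (hβ γ))).trans hγ
  obtain ⟨θ', hθ', hθlim⟩ := isCompact_isometries.ultrafilter_le_nhds (g.map θ)
    (Filter.le_principal_iff.mpr (Filter.mem_map.mpr (Filter.univ_mem' hθ)))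
  obtain ⟨t', -, htlim⟩ := (isCompact_monotone_closedBall (‖β.1‖ + 1)).ultrafilter_le_nhds
    (g.map fun γ => ⟨t γ, ht γ⟩) (Filter.le_principal_iff.mpr hbound)
  have hθt : Filter.Tendsto θ g (nhds θ') := hθlim
  have htt : Filter.Tendsto (fun γ => (⟨t γ, ht γ⟩ : {t : Fin d → ℝ // Monotone t})) g
    (nhds t') := htlim
  have hlim : β.1 = θ' ∘L diagCLM t'.1 ∘L adjoint θ' := by
    refine tendsto_nhds_unique hg' ?_
    have := (continuous_conj_diagCLM.tendsto (θ', t'.1)).comp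
      (hθt.prodMk_nhds ((continuous_subtype_val.tendsto t').comp htt))
    exact this.congr fun γ => (hβ γ).symm
  rw [hA β ⟨θ', hθ'⟩ t' hlim]
  have := (continuous_conj_diagCLM.tendsto (θ', (f t').1)).comp
    (hθt.prodMk_nhds (((continuous_subtype_val.comp hf).tendsto t').comp htt))
  exact this.congr fun γ => (hA γ ⟨θ γ, hθ γ⟩ ⟨t γ, ht γ⟩ (hβ γ)).symm

end

/-- If consecutive entries of `s` agree wherever those of the monotone tuple `t` do, then so do
arbitrary entries. -/
theorem eq_of_eq_of_forall_consecutive {d : ℕ} {t s : Fin d → ℝ} (ht : Monotone t)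
    (h : ∀ i j : Fin d, (i : ℕ) + 1 = j → t i = t j → s i = s j) (i j : Fin d)
    (hij : t i = t j) : s i = s j := by
  wlog hle : i ≤ j generalizing i j
  · exact (this j i hij.symm (le_of_not_ge hle)).symm
  obtain ⟨j, hj⟩ := j
  induction j with
  | zero => exact congrArg s (le_antisymm hle (Nat.zero_le _))
  | succ n ih =>
    rcases hle.eq_or_lt with he | hlt
    · exact congrArg s he
    · have hin : i ≤ (⟨n, by omega⟩ : Fin d) := Nat.lt_succ_iff.mp hlt
      have hn : t ⟨n, by omega⟩ = t ⟨n + 1, hj⟩ :=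
        le_antisymm (ht (Nat.le_succ n)) (hij ▸ ht hin)
      exact (ih (by omega) (hij.trans hn.symm) hin).trans (h _ _ rfl hn)

/-- Let `V` be a Hermitian space of dimension `d` and `f : D'(d) → D'(d)` a
continuous facial map.  Then there is exactly one map `A_f : s(V) → s(V)` with
`A_f (ν'(α,t)) = ν'(α, f t)` for all isometries `α : ℂ^d → V` and `t ∈ D'(d)`, where
`ν'(α,t) = α ∘ Δ(t) ∘ α†`; moreover this map is continuous, and explicitly: if `v` is an
orthonormal eigenbasis of `β` with monotone eigenvalue tuple `t` and `f t = s`, then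
`A_f β` is the self-adjoint endomorphism with `A_f β (v i) = s i • v i` (from which
`η' ∘ A_f = f ∘ η'` follows). -/
theorem miller_stmt8 {V : Type*} [NormedAddCommGroup V] [InnerProductSpace ℂ V]
    [FiniteDimensional ℂ V] (d : ℕ) (hd : Module.finrank ℂ V = d)
    (f : {t : Fin d → ℝ // Monotone t} → {t : Fin d → ℝ // Monotone t})
    (hf : Continuous f)
    (hfacial : ∀ (t : {t : Fin d → ℝ // Monotone t}) (i j : Fin d),
      (i : ℕ) + 1 = (j : ℕ) → (t : Fin d → ℝ) i = (t : Fin d → ℝ) j →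
      (f t : Fin d → ℝ) i = (f t : Fin d → ℝ) j) :
    ∃! A : {α : V →L[ℂ] V // IsSelfAdjoint α} → {α : V →L[ℂ] V // IsSelfAdjoint α},
      (∀ (β : {α : V →L[ℂ] V // IsSelfAdjoint α})
        (θ : {θ : EuclideanSpace ℂ (Fin d) →L[ℂ] V // ∀ x, ‖θ x‖ = ‖x‖})
        (t : {t : Fin d → ℝ // Monotone t}),
        (β : V →L[ℂ] V) = (θ : EuclideanSpace ℂ (Fin d) →L[ℂ] V) ∘L diagCLM t.1 ∘L
            ContinuousLinearMap.adjoint (θ : EuclideanSpace ℂ (Fin d) →L[ℂ] V) →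
        (A β : V →L[ℂ] V) = (θ : EuclideanSpace ℂ (Fin d) →L[ℂ] V) ∘L diagCLM (f t).1 ∘L
            ContinuousLinearMap.adjoint (θ : EuclideanSpace ℂ (Fin d) →L[ℂ] V)) ∧
      Continuous A ∧
      ∀ (β : {α : V →L[ℂ] V // IsSelfAdjoint α}) (t : Fin d → ℝ) (ht : Monotone t)
        (v : OrthonormalBasis (Fin d) ℂ V),
        (∀ i, (β : V →L[ℂ] V) (v i) = (t i : ℂ) • v i) →
        ∀ i, (A β : V →L[ℂ] V) (v i) = (((f ⟨t, ht⟩ : Fin d → ℝ) i : ℂ)) • v i := by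
  have hfac : ∀ (t : {t : Fin d → ℝ // Monotone t}) (i j : Fin d),
      t.1 i = t.1 j → (f t).1 i = (f t).1 j := fun t =>
    eq_of_eq_of_forall_consecutive t.2 (hfacial t)
  choose u w hu hw using fun β : {α : V →L[ℂ] V // IsSelfAdjoint α} =>
    exists_monotone_eigenbasis hd β.2
  choose θ hθ hθw using fun β => exists_isometry_eq_conj_diagCLM (w β)
  let A : {α : V →L[ℂ] V // IsSelfAdjoint α} → {α : V →L[ℂ] V // IsSelfAdjoint α} := fun β =>
    ⟨θ β ∘L diagCLM (f ⟨u β, hu β⟩).1 ∘L adjoint (θ β), isSelfAdjoint_conj_diagCLM _ _⟩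
  have hexpl : ∀ (β : {α : V →L[ℂ] V // IsSelfAdjoint α}) (t : Fin d → ℝ) (ht : Monotone t)
      (v : OrthonormalBasis (Fin d) ℂ V), (∀ i, β.1 (v i) = (t i : ℂ) • v i) →
      ∀ i, (A β).1 (v i) = ((f ⟨t, ht⟩).1 i : ℂ) • v i := by
    intro β t ht v hv
    obtain ⟨w', -, hw'⟩ := exists_orthonormalBasis_eq_conj_diagCLM_iff hd (θ β) (hθ β)
    have hβw' := (hw' _ _).mp (hθw β β.1 (u β) (hw β))
    obtain rfl := monotone_eigenvalues_unique ht (hu β) hv (hw β)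
    exact diagonal_of_diagonal_of_eigenbases β.2 (A β).2 (hfac ⟨u β, hu β⟩) hv hβw'
      ((hw' _ _).mp rfl)
  have hconj : ∀ (β : {α : V →L[ℂ] V // IsSelfAdjoint α})
      (θ : {θ : EuclideanSpace ℂ (Fin d) →L[ℂ] V // ∀ x, ‖θ x‖ = ‖x‖})
      (t : {t : Fin d → ℝ // Monotone t}),
      (β : V →L[ℂ] V) = θ.1 ∘L diagCLM t.1 ∘L adjoint θ.1 →
      (A β : V →L[ℂ] V) = θ.1 ∘L diagCLM (f t).1 ∘L adjoint θ.1 := by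
    intro β θ t h
    obtain ⟨v, -, hv⟩ := exists_orthonormalBasis_eq_conj_diagCLM_iff hd θ.1 θ.2
    exact (hv _ _).mpr (hexpl β t.1 t.2 v ((hv _ _).mp h))
  refine ⟨A, ⟨hconj, continuous_of_conj_diagCLM hd hf hconj, hexpl⟩, fun B hB => ?_⟩
  funext β
  exact Subtype.ext (hB.1 β ⟨θ β, hθ β⟩ ⟨u β, hu β⟩ (hθw β β.1 (u β) (hw β)))
end

section
/- Let V and W be Hermitian spaces with dim V ≤ dim W. The map ρ : Hom_ℂ(V,W) → s_+(V), γ ↦ (γ†γ)^{1/2}, is a continuous proper surjection. -/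
open ContinuousLinearMap

/-- A finite-dimensional inner product space embeds isometrically into any other one of at least
the same dimension. -/
theorem LinearIsometry.nonempty_of_finrank_le {𝕜 E F : Type*} [RCLike 𝕜] [NormedAddCommGroup E]
    [InnerProductSpace 𝕜 E] [FiniteDimensional 𝕜 E] [NormedAddCommGroup F]
    [InnerProductSpace 𝕜 F] [FiniteDimensional 𝕜 F]
    (h : Module.finrank 𝕜 E ≤ Module.finrank 𝕜 F) : Nonempty (E →ₗᵢ[𝕜] F) := by
  let b := stdOrthonormalBasis 𝕜 E
  let c := stdOrthonormalBasis 𝕜 F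
  have hf : b.toBasis.constr 𝕜 (c ∘ Fin.castLE h) ∘ b.toBasis = c ∘ Fin.castLE h :=
    funext fun i => b.toBasis.constr_basis 𝕜 _ i
  refine ⟨(b.toBasis.constr 𝕜 (c ∘ Fin.castLE h)).isometryOfOrthonormal (v := b.toBasis) ?_ ?_⟩
  · simp
  · rw [hf]
    exact c.orthonormal.comp _ (Fin.castLE_injective h)

/-- Let `V`, `W` be Hermitian spaces with `dim V ≤ dim W`.  The map
`ρ : Hom_ℂ(V,W) → s₊(V)`, `γ ↦ (γ†γ)^{1/2}` (i.e. any function assigning to each `γ` the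
unique positive semidefinite square root of `γ†γ`), is a continuous proper surjection onto
the space `s₊(V)` of positive semidefinite self-adjoint endomorphisms of `V`. -/
theorem miller_stmt9 {V W : Type*} [NormedAddCommGroup V] [InnerProductSpace ℂ V]
    [FiniteDimensional ℂ V] [NormedAddCommGroup W] [InnerProductSpace ℂ W]
    [FiniteDimensional ℂ W] (hdim : Module.finrank ℂ V ≤ Module.finrank ℂ W) :
    ∀ ρ : (V →L[ℂ] W) → (V →L[ℂ] V),
      (∀ γ, (ρ γ).IsPositive ∧ ρ γ ∘L ρ γ = ContinuousLinearMap.adjoint γ ∘L γ) →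
      Continuous ρ ∧
      (∀ β : V →L[ℂ] V, β.IsPositive → ∃ γ, ρ γ = β) ∧
      ∀ K : Set (V →L[ℂ] V), IsCompact K → IsCompact (ρ ⁻¹' K) := by
  intro ρ hρ
  have hsqrt : ∀ γ, CFC.sqrt (adjoint γ ∘L γ) = ρ γ := fun γ =>
    CFC.sqrt_unique (hρ γ).2 ((nonneg_iff_isPositive _).2 (hρ γ).1)
  have hcont : Continuous ρ := by
    rw [← funext hsqrt]
    refine CFC.continuousOn_sqrt.comp_continuous ?_ fun γ =>
      (nonneg_iff_isPositive _).2 (isPositive_adjoint_comp_self γ)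
    exact (adjoint.continuous).clm_comp continuous_id
  refine ⟨hcont, fun β hβ => ?_, fun K hK => ?_⟩
  · obtain ⟨ι⟩ := LinearIsometry.nonempty_of_finrank_le hdim
    refine ⟨ι.toContinuousLinearMap ∘L β, ?_⟩
    rw [← hsqrt]
    refine CFC.sqrt_unique ?_ ((nonneg_iff_isPositive _).2 hβ)
    ext v
    refine ext_inner_right ℂ fun w => ?_
    simp [adjoint_inner_left, hβ.isSelfAdjoint.isSymmetric.apply_clm]
  · have := FiniteDimensional.proper ℂ (V →L[ℂ] W)
    refine Metric.isCompact_of_isClosed_isBounded (hK.isClosed.preimage hcont) ?_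
    obtain ⟨C, hC⟩ := hK.isBounded.exists_norm_le
    refine isBounded_iff_forall_norm_le.2 ⟨C, fun γ hγ => le_trans ?_ (hC _ hγ)⟩
    refine le_of_sq_le_sq ?_ (norm_nonneg _)
    rw [sq, sq, ← norm_adjoint_comp_self, ← (hρ γ).2]
    exact opNorm_comp_le _ _
end
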